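/- For every integer N and all y, z ∈ K, the bilinear difference equation holds: φ_{N+1}(y/q,z)·φ_{N−1}(y,z) − φ_{N+1}(y,z)·φ_{N−1}(y/q,z) = (1 − q)·(y/q)·φ_N(y/q,z)·φ_N(y,z). -/

import Mathlib

open Matrix Finset

/-- The Jacobi--Trudi type determinant: `det (p (n - 2i + j) y z)_{0 ≤ i,j ≤ n-1}`. -/
noncomputable def phiAux {K : Type*} [Field K] (p : ℤ → K → K → K) (n : ℕ) (y z : K) : K :=
  Matrix.det (Matrix.of fun i j : Fin n => p ((n : ℤ) - 2 * ((i : ℕ) : ℤ) + ((j : ℕ) : ℤ)) y z)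

/-- The polynomials `φ_N(y,z)`: for `N ≥ 0` the Jacobi--Trudi determinant (with `φ_0 = 1`
as the empty determinant), and for `N < 0` we set `φ_N = (-1)^(N(N+1)/2) φ_(-N-1)`. -/
noncomputable def phi {K : Type*} [Field K] (p : ℤ → K → K → K) (N : ℤ) (y z : K) : K :=
  if 0 ≤ N then phiAux p N.toNat y z
  else (-1 : K) ^ (N * (N + 1) / 2) * phiAux p (-N - 1).toNat y z

section Pluecker

variable {K : Type*} [Field K]

/-- The three-term Plücker relation. -/
theorem det_pluecker {n : ℕ} (W : Fin n → Fin (n + 2) → K) (a b c d : Fin (n + 2) → K) :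
    det (of (vecCons a (vecCons b W))) * det (of (vecCons c (vecCons d W)))
      - det (of (vecCons a (vecCons c W))) * det (of (vecCons b (vecCons d W)))
      + det (of (vecCons a (vecCons d W))) * det (of (vecCons b (vecCons c W))) = 0 := by
  set l : (Fin (n + 2) → K) → K := fun x => det (of (vecCons a (vecCons x W))) with hl
  obtain ⟨v, hv⟩ : ∃ v : Fin (n + 2) → K, ∀ x, l x = ∑ j, x j * v j := by
    refine ⟨fun j => (-1) ^ (1 + (j : ℕ)) *
      det ((of (vecCons a (vecCons 0 W))).submatrix (Fin.succAbove 1) j.succAbove), fun x => ?_⟩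
    rw [hl]
    simp only
    rw [det_succ_row _ 1]
    refine Finset.sum_congr rfl fun j _ => ?_
    have : (of (vecCons a (vecCons x W))).submatrix (Fin.succAbove 1) j.succAbove
        = (of (vecCons a (vecCons 0 W))).submatrix (Fin.succAbove 1) j.succAbove := by
      ext i k
      refine Fin.cases ?_ (fun i => ?_) i
      · simp
      · simp
    rw [this]
    simp
    ring
  have hW (i : Fin n) : l (W i) = 0 :=
    det_zero_of_row_eq (i := 1) (j := i.succ.succ) (Fin.succ_succ_ne_one i).symm (by
      ext k
      simp)
  set X : Fin (n + 3) → Fin (n + 2) → K := vecCons b (vecCons c (vecCons d W)) with hX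
  have hdet : det (of fun i => (vecCons (l (X i)) (X i) : Fin (n + 3) → K)) = 0 := by
    refine exists_mulVec_eq_zero_iff.mp ⟨vecCons (-1) v, fun h => ?_, ?_⟩
    · simpa using congrFun h 0
    · ext i
      simp [mulVec, dotProduct, Fin.sum_univ_succ (n := n + 2), hv]
  have hsub (i : Fin (n + 3)) :
      (of fun i => (vecCons (l (X i)) (X i) : Fin (n + 3) → K)).submatrix i.succAbove Fin.succ
        = of fun k => X (i.succAbove k) := by
    ext k j
    simp
  have h0 : (fun k => X (Fin.succAbove 0 k)) = vecCons c (vecCons d W) := by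
    ext k
    simp [hX]
  have h1 : (fun k => X ((Fin.succ 0).succAbove k)) = vecCons b (vecCons d W) := by
    funext k
    refine Fin.cases ?_ (fun k => ?_) k
    · simp [hX]
    · simp [hX]
  have h2 : (fun k => X ((Fin.succ (Fin.succ 0)).succAbove k)) = vecCons b (vecCons c W) := by
    funext k
    refine Fin.cases ?_ (fun k => Fin.cases ?_ (fun k => ?_) k) k
    · rw [Fin.succ_succAbove_zero]
      simp [hX]
    · rw [Fin.succ_succAbove_succ]
      simp [hX]
    · rw [Fin.succ_succAbove_succ, Fin.succ_succAbove_succ]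
      simp [hX]
  rw [det_succ_column_zero, Fin.sum_univ_succ, Fin.sum_univ_succ, Fin.sum_univ_succ] at hdet
  simp only [hsub, h0, h1, h2] at hdet
  simp only [hX, Fin.val_succ, Fin.val_zero, of_apply, cons_val_zero, cons_val_succ, hW, mul_zero,
    zero_mul, Finset.sum_const_zero] at hdet
  linear_combination hdet

theorem det_vecCons_single_zero {m : ℕ} (g : Fin m → Fin (m + 1) → K) :
    det (of (vecCons (Pi.single 0 1) g)) = det (of fun i j => g i j.succ) := by
  rw [det_succ_row_zero, Fin.sum_univ_succ, Finset.sum_eq_zero]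
  · simp
    rfl
  · intro j _
    simp

theorem det_vecCons_pow {m : ℕ} (a : K) (g : Fin m → Fin (m + 1) → K) :
    det (of (vecCons (fun j => a ^ (j : ℕ)) g))
      = det (of fun i j => g i j.succ - a * g i j.castSucc) := by
  have h := det_vecCons_single_zero
    (fun i => vecCons (g i 0) fun j => g i j.succ - a * g i j.castSucc)
  simp only [cons_val_succ] at h
  rw [← h]
  refine det_eq_of_forall_col_eq_smul_add_pred (fun _ => a) (fun i => ?_) fun i j => ?_
  · refine Fin.cases ?_ (fun i => ?_) i <;> simp
  · refine Fin.cases ?_ (fun i => ?_) i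
    · simp [pow_succ, mul_comm]
    · simp

theorem det_vecCons_single_last {m : ℕ} (x : Fin (m + 2) → K) (g : Fin m → Fin (m + 2) → K) :
    det (of (vecCons x (vecCons (Pi.single (Fin.last (m + 1)) 1) g)))
      = (-1) ^ m * det (of (vecCons (fun j => x j.castSucc) fun i j => g i j.castSucc)) := by
  rw [det_succ_row _ 1, Finset.sum_eq_single (Fin.last (m + 1))]
  · have : (of (vecCons x (vecCons (Pi.single (Fin.last (m + 1)) 1) g))).submatrix
        (Fin.succAbove 1) (Fin.last (m + 1)).succAbove
        = of (vecCons (fun j => x j.castSucc) fun i j => g i j.castSucc) := by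
      ext i k
      refine Fin.cases ?_ (fun i => ?_) i
      · simp
      · simp
    rw [this]
    simp [pow_add]
  · intro j _ hj
    simp [hj]
  · simp

end Pluecker

section Staircase

variable {K : Type*} [Field K]

/-- The Jacobi–Trudi determinant of the staircase partition `(n, n - 1, …, 1)`. -/
noncomputable def staircaseDet (h : ℤ → K) (n : ℕ) : K :=
  det (of fun i j : Fin n => h ((n : ℤ) - 2 * ((i : ℕ) : ℤ) + ((j : ℕ) : ℤ)))

theorem staircaseDet_eq_det_succ {h : ℤ → K} (hneg : ∀ k < 0, h k = 0) (h0 : h 0 = 1) (n : ℕ) :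
    det (of fun i j : Fin (n + 1) => h ((n : ℤ) - 2 * ((i : ℕ) : ℤ) + ((j : ℕ) : ℤ)))
      = staircaseDet h n := by
  rw [det_succ_row _ (Fin.last n), Finset.sum_eq_single (Fin.last n)]
  · have e : (n : ℤ) - 2 * n + n = 0 := by ring
    simp [e, h0, staircaseDet, ← two_mul]
    rfl
  · intro j _ hj
    have : (j : ℕ) < n := Fin.val_lt_last hj
    rw [of_apply, hneg _ (by simp; omega)]
    simp
  · simp

theorem staircaseDet_bilinear {h h' : ℤ → K} {a : K} (hneg : ∀ k < 0, h k = 0) (h0 : h 0 = 1)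
    (hh' : ∀ k, h' k = h k - a * h (k - 1)) (n : ℕ) :
    staircaseDet h (n + 2) * staircaseDet h' n - staircaseDet h' (n + 2) * staircaseDet h n
      = a * staircaseDet h (n + 1) * staircaseDet h' (n + 1) := by
  have hneg' : ∀ k < 0, h' k = 0 := fun k hk => by
    rw [hh', hneg k hk, hneg _ (by omega)]
    ring
  have h0' : h' 0 = 1 := by
    rw [hh', h0, hneg _ (by omega)]
    ring
  set W : Fin (n + 1) → Fin (n + 3) → K := fun i j => h (n - 1 - 2 * (i : ℕ) + (j : ℕ)) with hW
  set r : Fin (n + 3) → K := fun j => h (n + 1 + (j : ℕ)) with hr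
  set A : Fin (n + 3) → K := fun j => a ^ (j : ℕ) with hA
  set e : Fin (n + 3) → K := Pi.single 0 1 with he
  set f : Fin (n + 3) → K := Pi.single (Fin.last (n + 2)) 1 with hf
  have hrW (i : Fin (n + 2)) (j : Fin (n + 3)) :
      (vecCons r W : Fin (n + 2) → Fin (n + 3) → K) i j = h (n + 1 - 2 * (i : ℕ) + (j : ℕ)) := by
    refine Fin.cases ?_ (fun i => ?_) i
    · simp [hr]
    · simp only [cons_val_succ, hW, Fin.val_succ]
      congr 1
      push_cast
      ring
  have her : det (of (vecCons e (vecCons r W))) = staircaseDet h (n + 2) := by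
    rw [he, det_vecCons_single_zero]
    simp only [hrW, staircaseDet]
    congr 3
    ext i j
    congr 1
    simp only [Fin.val_succ]
    push_cast
    ring
  have hAr : det (of (vecCons A (vecCons r W))) = staircaseDet h' (n + 2) := by
    rw [hA, det_vecCons_pow]
    simp only [hrW, staircaseDet, hh']
    congr 3
    ext i j
    simp only [Fin.val_succ, Fin.val_castSucc]
    push_cast
    ring_nf
  have hef : det (of (vecCons e (vecCons f W))) = (-1) ^ (n + 1) * staircaseDet h n := by
    have e' : (fun j : Fin (n + 2) => e j.castSucc) = Pi.single 0 1 := by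
      ext j
      simp [he, Pi.single_apply, Fin.castSucc_eq_zero_iff]
    rw [hf, det_vecCons_single_last, e', det_vecCons_single_zero,
      ← staircaseDet_eq_det_succ hneg h0]
    congr 4
    ext i j
    simp only [hW, Fin.val_succ, Fin.val_castSucc]
    push_cast
    ring_nf
  have hAf : det (of (vecCons A (vecCons f W))) = (-1) ^ (n + 1) * staircaseDet h' n := by
    rw [hf, det_vecCons_single_last]
    simp only [hA, Fin.val_castSucc]
    rw [det_vecCons_pow, ← staircaseDet_eq_det_succ hneg' h0']
    congr 4
    ext i j
    simp only [hW, hh', Fin.val_succ, Fin.val_castSucc]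
    push_cast
    ring_nf
  have hrf : det (of (vecCons r (vecCons f W))) = (-1) ^ (n + 1) * staircaseDet h (n + 1) := by
    rw [hf, det_vecCons_single_last, ← staircaseDet_eq_det_succ hneg h0]
    congr 3
    ext i j
    have := hrW i j.castSucc
    revert this
    refine Fin.cases ?_ (fun i => ?_) i <;> simp
  have heA : det (of (vecCons e (vecCons A W))) = a * staircaseDet h' (n + 1) := by
    have hsmul : (fun (i : Fin (n + 2)) (j : Fin (n + 2)) =>
        (vecCons A W : Fin (n + 2) → Fin (n + 3) → K) i j.succ)
        = Function.update (vecCons (fun j : Fin (n + 2) => a ^ (j : ℕ)) fun i j => W i j.succ) 0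
          (a • fun j : Fin (n + 2) => a ^ (j : ℕ)) := by
      ext i j
      refine Fin.cases ?_ (fun i => ?_) i
      · simp [hA, pow_succ, mul_comm]
      · simp
    rw [he, det_vecCons_single_zero, hsmul]
    have := det_updateRow_smul
      (of (vecCons (fun j : Fin (n + 2) => a ^ (j : ℕ)) fun i j => W i j.succ)) 0 a
      (fun j : Fin (n + 2) => a ^ (j : ℕ))
    refine this.trans ?_
    rw [show updateRow (of (vecCons (fun j : Fin (n + 2) => a ^ (j : ℕ)) fun i j => W i j.succ)) 0
      (fun j : Fin (n + 2) => a ^ (j : ℕ)) = _ from Function.update_eq_self 0 _, det_vecCons_pow]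
    simp only [staircaseDet, hh', hW]
    congr 4
    ext i j
    simp only [Fin.val_succ, Fin.val_castSucc]
    push_cast
    ring_nf
  have hrA : det (of (vecCons r (vecCons A W))) = -det (of (vecCons A (vecCons r W))) := by
    have hswap := det_permute (Equiv.swap 0 1) (of (vecCons A (vecCons r W)))
    rw [Equiv.Perm.sign_swap (by simp)] at hswap
    simp only [Units.val_neg, Units.val_one, Int.cast_neg, Int.cast_one, neg_mul, one_mul] at hswap
    rw [← hswap]
    congr 1
    ext i j
    refine Fin.cases ?_ (fun i => Fin.cases ?_ (fun i => ?_) i) i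
    · simp
    · simp
    · rw [submatrix_apply, Equiv.swap_apply_of_ne_of_ne (by simp)
        (Fin.succ_succ_ne_one i)]
      simp
  have key := det_pluecker W e r A f
  rw [hrA, her, hAf, heA, hrf, hef, hAr] at key
  have hs : ((-1 : K) ^ (n + 1)) * (-1) ^ (n + 1) = 1 := by
    rw [← mul_pow]
    simp
  linear_combination (-1 : K) ^ (n + 1) * key - (staircaseDet h (n + 2) * staircaseDet h' n
    - staircaseDet h' (n + 2) * staircaseDet h n
    - a * staircaseDet h (n + 1) * staircaseDet h' (n + 1)) * hs

theorem phi_natCast (p : ℤ → K → K → K) (n : ℕ) (y z : K) :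
    phi p n y z = staircaseDet (fun k => p k y z) n := by
  simp [phi, phiAux, staircaseDet]

theorem phi_neg_sub_one (p : ℤ → K → K → K) (N : ℤ) (y z : K) :
    phi p (-N - 1) y z = (-1 : K) ^ (N * (N + 1) / 2) * phi p N y z := by
  have e : (-N - 1) * (-N - 1 + 1) = N * (N + 1) := by ring
  have e' : -(-N - 1) - 1 = N := by ring
  by_cases hN : 0 ≤ N
  · rw [phi, phi, if_neg (by omega), if_pos hN, e, e']
  · rw [phi, phi, if_pos (by omega), if_neg hN, ← mul_assoc, ← mul_zpow]
    simp

end Staircase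

theorem bilinear_bl5
    {K : Type*} [Field K] (q : K) (hq0 : q ≠ 0)
    (hq1 : ∀ k : ℕ, 1 ≤ k → q ^ k ≠ 1)
    (p : ℤ → K → K → K)
    (hp_neg : ∀ k : ℤ, k < 0 → ∀ y z : K, p k y z = 0)
    (hp_zero : ∀ y z : K, p 0 y z = 1)
    (hC1 : ∀ k : ℕ, 1 ≤ k → ∀ y z : K,
      (∑ i ∈ Finset.range k, q ^ i) * p (k : ℤ) y z
        = (y + z + q ^ (k - 1)) * p ((k : ℤ) - 1) y z
          - (1 - q) * y * z * p ((k : ℤ) - 2) y z)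
    (hC2 : ∀ (k : ℤ) (y z : K), p k y (q * z) - p k y z = (q - 1) * z * p (k - 1) y z)
    (hC3 : ∀ (k : ℤ) (y z : K), p k (q * y) z - p k y z = (q - 1) * y * p (k - 1) y z)
    (N : ℤ) (y z : K) :
    phi p (N + 1) (y / q) z * phi p (N - 1) y z
      - phi p (N + 1) y z * phi p (N - 1) (y / q) z
    = (1 - q) * (y / q) * phi p N (y / q) z * phi p N y z := by
  have nonneg (n : ℕ) : phi p (n + 1) (y / q) z * phi p (n - 1) y z
      - phi p (n + 1) y z * phi p (n - 1) (y / q) z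
      = (1 - q) * (y / q) * phi p n (y / q) z * phi p n y z := by
    have hstep (k : ℤ) : p k y z = p k (y / q) z - (1 - q) * (y / q) * p (k - 1) (y / q) z := by
      have := hC3 k (y / q) z
      rw [mul_div_cancel₀ _ hq0] at this
      linear_combination this
    cases n with
    | zero =>
      have h1 := hstep 1
      simp [hp_zero] at h1
      simp [phi, phiAux, h1]
    | succ n =>
      have := staircaseDet_bilinear (h := fun k => p k (y / q) z) (h' := fun k => p k y z)
        (fun k hk => hp_neg k hk _ _) (hp_zero _ _) hstep n
      simp only [← phi_natCast] at this
      push_cast at this ⊢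
      rw [add_sub_cancel_right, add_assoc, one_add_one_eq_two]
      exact this
  obtain ⟨n, rfl | hn⟩ : ∃ n : ℕ, N = n ∨ N = -n - 1 := by
    rcases le_total 0 N with h | h
    · exact ⟨N.toNat, Or.inl (by omega)⟩
    · by_cases h0 : N = 0
      · exact ⟨0, Or.inl (by omega)⟩
      · exact ⟨(-N - 1).toNat, Or.inr (by omega)⟩
  · exact nonneg n
  · have e1 : N + 1 = -((n : ℤ) - 1) - 1 := by omega
    have e2 : N - 1 = -((n : ℤ) + 1) - 1 := by omega
    have hne : (-1 : K) ≠ 0 := by simp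
    have hsign : (-1 : K) ^ (((n : ℤ) - 1) * ((n : ℤ) - 1 + 1) / 2)
        * (-1 : K) ^ (((n : ℤ) + 1) * ((n : ℤ) + 1 + 1) / 2) = -1 := by
      obtain ⟨m, hm⟩ := Int.even_mul_pred_self (n : ℤ)
      rw [← zpow_add₀ hne, show ((n : ℤ) - 1) * ((n : ℤ) - 1 + 1) / 2 = m by
          rw [show ((n : ℤ) - 1) * ((n : ℤ) - 1 + 1) = m * 2 by linear_combination hm]
          simp,
        show ((n : ℤ) + 1) * ((n : ℤ) + 1 + 1) / 2 = m + (2 * n + 1) by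
          rw [show ((n : ℤ) + 1) * ((n : ℤ) + 1 + 1) = (m + (2 * n + 1)) * 2 by
            linear_combination hm]
          simp]
      exact Odd.neg_one_zpow ⟨m + n, by ring⟩
    have hsq : (-1 : K) ^ ((n : ℤ) * (n + 1) / 2) * (-1 : K) ^ ((n : ℤ) * (n + 1) / 2) = 1 := by
      rw [← mul_zpow]
      simp
    rw [e1, e2, hn]
    simp only [phi_neg_sub_one]
    linear_combination (phi p (n - 1) (y / q) z * phi p (n + 1) y z
      - phi p (n - 1) y z * phi p (n + 1) (y / q) z) * hsign
      - (1 - q) * (y / q) * phi p n (y / q) z * phi p n y z * hsq + nonneg n
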